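/- Let (p, x, σ, β) be admissible parameters with z = p − Σ_{i=1}^{n−1} x_i²/σ_i > 0, and let R be the curvature operator of the inner product ⟨·,·⟩ = S(p, x, σ, β) on 𝔠𝔥(n). Then for every i ∈ {1,…,n−1}: R(X, Y_i) = −(1/(4z))·X∧Y_i − (1/(4σ_i))·Z_i∧W as endomorphisms of 𝔠𝔥(n). -/

import Mathlib

noncomputable section

open Matrix BigOperators Finset

namespace CHn

/-- Structure constants of the Lie algebra 𝔠𝔥(n) in the ordered basis
`(X, Y_1, …, Y_{n-1}, Z_1, …, Z_{n-1}, W)`: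
index `0 ↦ X`, indices `1,…,n-1 ↦ Y_1,…,Y_{n-1}`,
indices `n,…,2n-2 ↦ Z_1,…,Z_{n-1}`, index `2n-1 ↦ W`.
The nonzero brackets are `[X,Y_i] = (1/2)Y_i`, `[X,Z_i] = (1/2)Z_i`,
`[X,W] = W`, `[Z_j,Y_i] = δ_{ij} W`. -/
def structC (n : ℕ) (i j k : Fin (2 * n)) : ℝ :=
  (if i.val = 0 ∧ j = k ∧ 1 ≤ j.val ∧ j.val ≤ 2 * n - 2 then (1 : ℝ) / 2 else 0)
  - (if j.val = 0 ∧ i = k ∧ 1 ≤ i.val ∧ i.val ≤ 2 * n - 2 then (1 : ℝ) / 2 else 0)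
  + (if i.val = 0 ∧ j.val = 2 * n - 1 ∧ k.val = 2 * n - 1 then (1 : ℝ) else 0)
  - (if j.val = 0 ∧ i.val = 2 * n - 1 ∧ k.val = 2 * n - 1 then (1 : ℝ) else 0)
  + (if n ≤ i.val ∧ i.val ≤ 2 * n - 2 ∧ i.val = j.val + (n - 1) ∧ k.val = 2 * n - 1
      then (1 : ℝ) else 0)
  - (if n ≤ j.val ∧ j.val ≤ 2 * n - 2 ∧ j.val = i.val + (n - 1) ∧ k.val = 2 * n - 1
      then (1 : ℝ) else 0)

/-- The Lie bracket of `𝔠𝔥(n)`, as a bilinear operation on coordinate vectors. -/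
def bracket (n : ℕ) (u v : Fin (2 * n) → ℝ) : Fin (2 * n) → ℝ :=
  fun k => ∑ i, ∑ j, u i * v j * structC n i j k

/-- `F` is the matrix (in the ordered basis) of a Lie algebra automorphism of `𝔠𝔥(n)`. -/
def IsAut (n : ℕ) (F : Matrix (Fin (2 * n)) (Fin (2 * n)) ℝ) : Prop :=
  IsUnit F ∧ ∀ u v, F.mulVec (bracket n u v) = bracket n (F.mulVec u) (F.mulVec v)

/-- The normal form `S(p, x, σ, β)`: the block matrix
`[[p, xᵀ, 0, 0], [x, σ, 0, 0], [0, 0, σ, 0], [0, 0, 0, β]]`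
with blocks of sizes `1, n-1, n-1, 1`. -/
def Sform (n : ℕ) (p : ℝ) (x σ : Fin (n - 1) → ℝ) (β : ℝ) :
    Matrix (Fin (2 * n)) (Fin (2 * n)) ℝ := fun i j =>
  if i.val = 0 ∧ j.val = 0 then p
  else if h : i.val = 0 ∧ 1 ≤ j.val ∧ j.val ≤ n - 1 then x ⟨j.val - 1, by omega⟩
  else if h : j.val = 0 ∧ 1 ≤ i.val ∧ i.val ≤ n - 1 then x ⟨i.val - 1, by omega⟩
  else if h : i = j ∧ 1 ≤ i.val ∧ i.val ≤ n - 1 then σ ⟨i.val - 1, by omega⟩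
  else if h : i = j ∧ n ≤ i.val ∧ i.val ≤ 2 * n - 2 then σ ⟨i.val - n, by omega⟩
  else if i = j ∧ i.val = 2 * n - 1 then β
  else 0

/-- Admissibility of the parameters `(p, x, σ, β)`:
`p, β > 0`, all `x_i ≥ 0`, `σ_1 ≥ … ≥ σ_{n-2} ≥ 1` and the convention `σ_{n-1} = 1`. -/
def Admissible (n : ℕ) (p : ℝ) (x σ : Fin (n - 1) → ℝ) (β : ℝ) : Prop :=
  0 < p ∧ 0 < β ∧ (∀ i, 0 ≤ x i) ∧ Antitone σ ∧ (∀ i, 1 ≤ σ i) ∧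
    ∀ _h : 1 ≤ n - 1, σ ⟨n - 2, by omega⟩ = 1

/-- `z = p - Σ_i x_i² / σ_i`. -/
def zval (n : ℕ) (p : ℝ) (x σ : Fin (n - 1) → ℝ) : ℝ :=
  p - ∑ i, (x i) ^ 2 / σ i

/-- The inner product on `𝔠𝔥(n)` determined by a matrix `S`. -/
def ip (n : ℕ) (S : Matrix (Fin (2 * n)) (Fin (2 * n)) ℝ) (u v : Fin (2 * n) → ℝ) : ℝ :=
  u ⬝ᵥ S.mulVec v

/-- The coordinates (w.r.t. the standard basis) of the Koszul form
`K(u,v)(T) = ⟨[u,v],T⟩ - ⟨[v,T],u⟩ + ⟨[T,u],v⟩`. -/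
def koszul (n : ℕ) (S : Matrix (Fin (2 * n)) (Fin (2 * n)) ℝ)
    (u v : Fin (2 * n) → ℝ) : Fin (2 * n) → ℝ := fun t =>
  ip n S (bracket n u v) (Pi.single t 1) - ip n S (bracket n v (Pi.single t 1)) u
    + ip n S (bracket n (Pi.single t 1) u) v

/-- The Levi-Civita product `∇_u v` of the inner product `S`,
i.e. the unique solution of the Koszul formula `2⟨∇_u v, T⟩ = K(u,v)(T)`
(for invertible symmetric `S`). -/
def nabla (n : ℕ) (S : Matrix (Fin (2 * n)) (Fin (2 * n)) ℝ)
    (u v : Fin (2 * n) → ℝ) : Fin (2 * n) → ℝ :=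
  (2 : ℝ)⁻¹ • (S⁻¹).mulVec (koszul n S u v)

/-- The curvature operator `R(u,v)w = ∇_u∇_v w - ∇_v∇_u w - ∇_{[u,v]} w`. -/
def curv (n : ℕ) (S : Matrix (Fin (2 * n)) (Fin (2 * n)) ℝ)
    (u v w : Fin (2 * n) → ℝ) : Fin (2 * n) → ℝ :=
  nabla n S u (nabla n S v w) - nabla n S v (nabla n S u w) - nabla n S (bracket n u v) w

/-- The Ricci form `Ric(u,v) = tr (T ↦ R(T,u)v)`. -/
def ricci (n : ℕ) (S : Matrix (Fin (2 * n)) (Fin (2 * n)) ℝ)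
    (u v : Fin (2 * n) → ℝ) : ℝ :=
  ∑ t, curv n S (Pi.single t 1) u v t

/-- The scalar curvature `τ = Σ_{i,j} g^{ij} Ric(e_i, e_j)`. -/
def scalarCurv (n : ℕ) (S : Matrix (Fin (2 * n)) (Fin (2 * n)) ℝ) : ℝ :=
  ∑ i, ∑ j, (S⁻¹) i j * ricci n S (Pi.single i 1) (Pi.single j 1)

/-- The wedge endomorphism `(u∧v)(w) = ⟨v,w⟩u - ⟨u,w⟩v`. -/
def wedge (n : ℕ) (S : Matrix (Fin (2 * n)) (Fin (2 * n)) ℝ)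
    (u v : Fin (2 * n) → ℝ) : (Fin (2 * n) → ℝ) → (Fin (2 * n) → ℝ) :=
  fun w => ip n S v w • u - ip n S u w • v

/-- The standard symplectic matrix `J_m = [[0, I_m], [-I_m, 0]]`. -/
def Jmat (m : ℕ) : Matrix (Fin (2 * m)) (Fin (2 * m)) ℝ := fun i j =>
  if j.val = i.val + m then 1 else if i.val = j.val + m then -1 else 0

/-- The block matrix `[[1, 0, 0], [u, M, 0], [a, vᵀ, λ]]`
with blocks of sizes `1, 2n-2, 1`. -/
def blockF (n : ℕ) (M : Matrix (Fin (2 * (n - 1))) (Fin (2 * (n - 1))) ℝ)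
    (u v : Fin (2 * (n - 1)) → ℝ) (a lam : ℝ) :
    Matrix (Fin (2 * n)) (Fin (2 * n)) ℝ := fun i j =>
  if i.val = 0 then (if j.val = 0 then 1 else 0)
  else if h : 1 ≤ i.val ∧ i.val ≤ 2 * n - 2 then
    (if j.val = 0 then u ⟨i.val - 1, by omega⟩
     else if h2 : 1 ≤ j.val ∧ j.val ≤ 2 * n - 2 then
       M ⟨i.val - 1, by omega⟩ ⟨j.val - 1, by omega⟩
     else 0)
  else
    (if j.val = 0 then a
     else if h2 : 1 ≤ j.val ∧ j.val ≤ 2 * n - 2 then v ⟨j.val - 1, by omega⟩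
     else lam)

/-- The metric is Einstein: the Ricci form is proportional to the inner product. -/
def IsEinstein (n : ℕ) (S : Matrix (Fin (2 * n)) (Fin (2 * n)) ℝ) : Prop :=
  ∃ c : ℝ, ∀ u v, ricci n S u v = c * ip n S u v

end CHn

namespace CHn

set_option linter.unnecessarySeqFocus false
set_option linter.unreachableTactic false
set_option linter.unusedTactic false
set_option linter.unusedSimpArgs false
set_option linter.unusedVariables false

/-- index of `X` -/
def iX (m : ℕ) : Fin (2 * (m + 1)) := ⟨0, by omega⟩
/-- index of `Y_j` -/
def iY {m : ℕ} (j : Fin m) : Fin (2 * (m + 1)) := ⟨j.val + 1, by have := j.isLt; omega⟩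
/-- index of `Z_j` -/
def iZ {m : ℕ} (j : Fin m) : Fin (2 * (m + 1)) := ⟨j.val + (m + 1), by have := j.isLt; omega⟩
/-- index of `W` -/
def iW (m : ℕ) : Fin (2 * (m + 1)) := ⟨2 * (m + 1) - 1, by omega⟩

lemma idx_cases {m : ℕ} {P : Fin (2 * (m + 1)) → Prop} (hX : P (iX m)) (hY : ∀ j, P (iY j))
    (hZ : ∀ j, P (iZ j)) (hW : P (iW m)) (k : Fin (2 * (m + 1))) : P k := by
  obtain ⟨k, hk⟩ := k
  by_cases h0 : k = 0
  · subst h0; exact hX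
  by_cases h1 : k ≤ m
  · have := hY ⟨k - 1, by omega⟩
    convert this using 1
    simp only [iY, Fin.mk.injEq]; omega
  by_cases h2 : k ≤ 2 * m
  · have := hZ ⟨k - (m + 1), by omega⟩
    convert this using 1
    simp only [iZ, Fin.mk.injEq]; omega
  · convert hW using 1
    simp only [iW, Fin.mk.injEq]; omega

/-- reindexing of the basis -/
def toIdx (m : ℕ) : (Unit ⊕ Fin m) ⊕ (Fin m ⊕ Unit) → Fin (2 * (m + 1))
  | .inl (.inl _) => iX m
  | .inl (.inr j) => iY j
  | .inr (.inl j) => iZ j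
  | .inr (.inr _) => iW m

lemma toIdx_bij (m : ℕ) : Function.Bijective (toIdx m) := by
  rw [Fintype.bijective_iff_surjective_and_card]
  constructor
  · intro k
    refine idx_cases (P := fun k => ∃ a, toIdx m a = k) ⟨.inl (.inl ()), rfl⟩
      (fun j => ⟨.inl (.inr j), rfl⟩) (fun j => ⟨.inr (.inl j), rfl⟩) ⟨.inr (.inr ()), rfl⟩ k
  · simp; omega

lemma sum_idx {m : ℕ} (f : Fin (2 * (m + 1)) → ℝ) :
    ∑ k, f k = f (iX m) + ∑ j : Fin m, f (iY j) + ∑ j : Fin m, f (iZ j) + f (iW m) := by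
  rw [← (toIdx_bij m).sum_comp f]
  simp [toIdx, Fintype.sum_sum_type]
  ring

section vals
variable {m : ℕ} (j k : Fin m)

lemma XY : (iX m = iY j) = False := by simp [iX, iY]
lemma YX : (iY j = iX m) = False := by simp [iX, iY]
lemma XZ : (iX m = iZ j) = False := by simp [iX, iZ]
lemma ZX : (iZ j = iX m) = False := by simp [iX, iZ]
lemma XW : (iX m = iW m) = False := by simp [iX, iW]; omega
lemma WX : (iW m = iX m) = False := by simp [iX, iW]; omega
lemma YZ : (iY j = iZ k) = False := by simp [iY, iZ]; omega
lemma ZY : (iZ k = iY j) = False := by simp [iY, iZ]; omega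
lemma YW : (iY j = iW m) = False := by simp [iY, iW]; omega
lemma WY : (iW m = iY j) = False := by simp [iY, iW]; omega
lemma ZW : (iZ j = iW m) = False := by simp [iZ, iW]; omega
lemma WZ : (iW m = iZ j) = False := by simp [iZ, iW]; omega
lemma YY : (iY j = iY k) = (j = k) := by simp [iY, Fin.ext_iff]
lemma ZZ : (iZ j = iZ k) = (j = k) := by simp [iZ, Fin.ext_iff]

end vals

/-- structure constants in terms of the named indices -/
lemma structC_eq {m : ℕ} (i j k : Fin (2 * (m + 1))) : structC (m + 1) i j k =
  (if i = iX m ∧ j = k ∧ j ≠ iX m ∧ j ≠ iW m then (1 : ℝ) / 2 else 0)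
  - (if j = iX m ∧ i = k ∧ i ≠ iX m ∧ i ≠ iW m then (1 : ℝ) / 2 else 0)
  + (if i = iX m ∧ j = iW m ∧ k = iW m then (1 : ℝ) else 0)
  - (if j = iX m ∧ i = iW m ∧ k = iW m then (1 : ℝ) else 0)
  + (if (∃ l : Fin m, i = iZ l ∧ j = iY l) ∧ k = iW m then (1 : ℝ) else 0)
  - (if (∃ l : Fin m, j = iZ l ∧ i = iY l) ∧ k = iW m then (1 : ℝ) else 0) := by
  have key : ∀ a b : Fin (2 * (m + 1)), (∃ l : Fin m, a = iZ l ∧ b = iY l) ↔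
      (m + 1 ≤ a.val ∧ a.val ≤ 2 * (m + 1) - 2 ∧ a.val = b.val + m) := by
    intro a b
    constructor
    · rintro ⟨l, rfl, rfl⟩
      have := l.isLt
      simp only [iZ, iY]; omega
    · rintro ⟨h1, h2, h3⟩
      refine ⟨⟨a.val - (m + 1), by omega⟩, ?_, ?_⟩ <;> apply Fin.ext <;> simp only [iZ, iY] <;> omega
  have hb : ∀ a : Fin (2 * (m + 1)), (a ≠ iX m ∧ a ≠ iW m) ↔
      (1 ≤ a.val ∧ a.val ≤ 2 * (m + 1) - 2) := by
    intro a
    have := a.isLt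
    simp only [Fin.ext_iff, iX, iW, ne_eq]; omega
  have hX : ∀ a : Fin (2 * (m + 1)), a = iX m ↔ a.val = 0 := by
    intro a; simp only [Fin.ext_iff, iX]
  have hW : ∀ a : Fin (2 * (m + 1)), a = iW m ↔ a.val = 2 * (m + 1) - 1 := by
    intro a; simp only [Fin.ext_iff, iW]
  unfold structC
  simp only [key, hb, Nat.add_sub_cancel, and_assoc]
  simp only [hX, hW]

lemma bracket_X {m : ℕ} (u v : Fin (2 * (m + 1)) → ℝ) : bracket (m + 1) u v (iX m) = 0 := by
  simp only [bracket, structC_eq]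
  simp only [XW, and_false, if_false]
  apply Finset.sum_eq_zero; intro i _
  apply Finset.sum_eq_zero; intro j _
  rw [if_neg, if_neg]
  · ring
  · tauto
  · tauto

lemma bracket_Y {m : ℕ} (u v : Fin (2 * (m + 1)) → ℝ) (k : Fin m) :
    bracket (m + 1) u v (iY k) = (u (iX m) * v (iY k) - v (iX m) * u (iY k)) / 2 := by
  simp only [bracket, structC_eq]
  simp only [sum_idx]
  simp [XY, YX, XZ, ZX, XW, WX, YZ, ZY, YW, WY, ZW, WZ, YY, ZZ]
  ring

lemma bracket_Z {m : ℕ} (u v : Fin (2 * (m + 1)) → ℝ) (k : Fin m) :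
    bracket (m + 1) u v (iZ k) = (u (iX m) * v (iZ k) - v (iX m) * u (iZ k)) / 2 := by
  simp only [bracket, structC_eq]
  simp only [sum_idx]
  simp [XY, YX, XZ, ZX, XW, WX, YZ, ZY, YW, WY, ZW, WZ, YY, ZZ]
  ring

lemma bracket_W {m : ℕ} (u v : Fin (2 * (m + 1)) → ℝ) :
    bracket (m + 1) u v (iW m) = u (iX m) * v (iW m) - v (iX m) * u (iW m)
      + ∑ k : Fin m, u (iZ k) * v (iY k) - ∑ k : Fin m, u (iY k) * v (iZ k) := by
  simp only [bracket, structC_eq]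
  simp only [sum_idx]
  simp [XY, YX, XZ, ZX, XW, WX, YZ, ZY, YW, WY, ZW, WZ, YY, ZZ]
  ring

section S
variable {m : ℕ} (p : ℝ) (x σ : Fin m → ℝ) (β : ℝ)

lemma S_X (v : Fin (2 * (m + 1)) → ℝ) : (Sform (m + 1) p x σ β).mulVec v (iX m) =
    p * v (iX m) + ∑ j : Fin m, x j * v (iY j) := by
  simp only [mulVec, dotProduct, sum_idx]
  have hY : ∀ j : Fin m, Sform (m + 1) p x σ β (iX m) (iY j) = x j := by
    intro j; have := j.isLt
    simp only [Sform, iX, iY, iZ, iW, Fin.ext_iff, true_and, and_true, false_and, and_false,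
      ↓reduceIte, ↓reduceDIte] <;> (try split_ifs) <;> first | rfl | (exfalso; omega) | (casesm* _ ∧ _ <;> contradiction) | (congr 1; apply Fin.ext; simp; done)
  have hZ : ∀ j : Fin m, Sform (m + 1) p x σ β (iX m) (iZ j) = 0 := by
    intro j; have := j.isLt
    simp only [Sform, iX, iY, iZ, iW, Fin.ext_iff, true_and, and_true, false_and, and_false,
      ↓reduceIte, ↓reduceDIte] <;> (try split_ifs) <;> first | rfl | (exfalso; omega) | (casesm* _ ∧ _ <;> contradiction) | (congr 1; apply Fin.ext; simp; done)
  have hW : Sform (m + 1) p x σ β (iX m) (iW m) = 0 := by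
    simp only [Sform, iX, iY, iZ, iW, Fin.ext_iff, true_and, and_true, false_and, and_false,
      ↓reduceIte, ↓reduceDIte] <;> (try split_ifs) <;> first | rfl | (exfalso; omega) | (casesm* _ ∧ _ <;> contradiction) | (congr 1; apply Fin.ext; simp; done)
  have hX : Sform (m + 1) p x σ β (iX m) (iX m) = p := by
    simp only [Sform, iX, iY, iZ, iW, Fin.ext_iff, true_and, and_true, false_and, and_false,
      ↓reduceIte, ↓reduceDIte] <;> (try split_ifs) <;> first | rfl | (exfalso; omega) | (casesm* _ ∧ _ <;> contradiction) | (congr 1; apply Fin.ext; simp; done)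
  simp [hX, hY, hZ, hW]

lemma S_Y (v : Fin (2 * (m + 1)) → ℝ) (k : Fin m) : (Sform (m + 1) p x σ β).mulVec v (iY k) =
    x k * v (iX m) + σ k * v (iY k) := by
  have hk := k.isLt
  simp only [mulVec, dotProduct, sum_idx]
  have hY : ∀ j : Fin m, Sform (m + 1) p x σ β (iY k) (iY j) = if k = j then σ k else 0 := by
    intro j; have := j.isLt
    simp only [Sform, iX, iY, iZ, iW, Fin.ext_iff, true_and, and_true, false_and, and_false,
      ↓reduceIte, ↓reduceDIte] <;> (try split_ifs) <;> first | rfl | (exfalso; omega) | (casesm* _ ∧ _ <;> contradiction) | (congr 1; apply Fin.ext; simp; done)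
  have hZ : ∀ j : Fin m, Sform (m + 1) p x σ β (iY k) (iZ j) = 0 := by
    intro j; have := j.isLt
    simp only [Sform, iX, iY, iZ, iW, Fin.ext_iff, true_and, and_true, false_and, and_false,
      ↓reduceIte, ↓reduceDIte] <;> (try split_ifs) <;> first | rfl | (exfalso; omega) | (casesm* _ ∧ _ <;> contradiction) | (congr 1; apply Fin.ext; simp; done)
  have hW : Sform (m + 1) p x σ β (iY k) (iW m) = 0 := by
    simp only [Sform, iX, iY, iZ, iW, Fin.ext_iff, true_and, and_true, false_and, and_false,
      ↓reduceIte, ↓reduceDIte] <;> (try split_ifs) <;> first | rfl | (exfalso; omega) | (casesm* _ ∧ _ <;> contradiction) | (congr 1; apply Fin.ext; simp; done)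
  have hX : Sform (m + 1) p x σ β (iY k) (iX m) = x k := by
    simp only [Sform, iX, iY, iZ, iW, Fin.ext_iff, true_and, and_true, false_and, and_false,
      ↓reduceIte, ↓reduceDIte] <;> (try split_ifs) <;> first | rfl | (exfalso; omega) | (casesm* _ ∧ _ <;> contradiction) | (congr 1; apply Fin.ext; simp; done)
  simp [hX, hY, hZ, hW]

lemma S_Z (v : Fin (2 * (m + 1)) → ℝ) (k : Fin m) : (Sform (m + 1) p x σ β).mulVec v (iZ k) =
    σ k * v (iZ k) := by
  have hk := k.isLt
  simp only [mulVec, dotProduct, sum_idx]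
  have hY : ∀ j : Fin m, Sform (m + 1) p x σ β (iZ k) (iY j) = 0 := by
    intro j; have := j.isLt
    simp only [Sform, iX, iY, iZ, iW, Fin.ext_iff, true_and, and_true, false_and, and_false,
      ↓reduceIte, ↓reduceDIte] <;> (try split_ifs) <;> first | rfl | (exfalso; omega) | (casesm* _ ∧ _ <;> contradiction) | (congr 1; apply Fin.ext; simp; done)
  have hZ : ∀ j : Fin m, Sform (m + 1) p x σ β (iZ k) (iZ j) = if k = j then σ k else 0 := by
    intro j; have := j.isLt
    simp only [Sform, iX, iY, iZ, iW, Fin.ext_iff, true_and, and_true, false_and, and_false,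
      ↓reduceIte, ↓reduceDIte] <;> (try split_ifs) <;> first | rfl | (exfalso; omega) | (casesm* _ ∧ _ <;> contradiction) | (congr 1; apply Fin.ext; simp; done)
  have hW : Sform (m + 1) p x σ β (iZ k) (iW m) = 0 := by
    simp only [Sform, iX, iY, iZ, iW, Fin.ext_iff, true_and, and_true, false_and, and_false,
      ↓reduceIte, ↓reduceDIte] <;> (try split_ifs) <;> first | rfl | (exfalso; omega) | (casesm* _ ∧ _ <;> contradiction) | (congr 1; apply Fin.ext; simp; done)
  have hX : Sform (m + 1) p x σ β (iZ k) (iX m) = 0 := by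
    simp only [Sform, iX, iY, iZ, iW, Fin.ext_iff, true_and, and_true, false_and, and_false,
      ↓reduceIte, ↓reduceDIte] <;> (try split_ifs) <;> first | rfl | (exfalso; omega) | (casesm* _ ∧ _ <;> contradiction) | (congr 1; apply Fin.ext; simp; done)
  simp [hX, hY, hZ, hW]

lemma S_W (v : Fin (2 * (m + 1)) → ℝ) : (Sform (m + 1) p x σ β).mulVec v (iW m) =
    β * v (iW m) := by
  simp only [mulVec, dotProduct, sum_idx]
  have e : 2 * (m + 1) - 1 = 2 * m + 1 := by omega
  have hY : ∀ j : Fin m, Sform (m + 1) p x σ β (iW m) (iY j) = 0 := by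
    intro j; have := j.isLt
    simp only [Sform, iX, iY, iZ, iW, Fin.ext_iff, true_and, and_true, false_and, and_false,
      ↓reduceIte, ↓reduceDIte] <;> (try split_ifs) <;> first | rfl | (exfalso; omega) | (casesm* _ ∧ _ <;> contradiction) | (congr 1; apply Fin.ext; simp; done)
  have hZ : ∀ j : Fin m, Sform (m + 1) p x σ β (iW m) (iZ j) = 0 := by
    intro j; have := j.isLt
    simp only [Sform, iX, iY, iZ, iW, Fin.ext_iff, true_and, and_true, false_and, and_false,
      ↓reduceIte, ↓reduceDIte] <;> (try split_ifs) <;> first | rfl | (exfalso; omega) | (casesm* _ ∧ _ <;> contradiction) | (congr 1; apply Fin.ext; simp; done)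
  have hW : Sform (m + 1) p x σ β (iW m) (iW m) = β := by
    simp only [Sform, iX, iY, iZ, iW, Fin.ext_iff, true_and, and_true, false_and, and_false,
      ↓reduceIte, ↓reduceDIte] <;> (try split_ifs) <;> first | rfl | (exfalso; omega) | (casesm* _ ∧ _ <;> contradiction) | (congr 1; apply Fin.ext; simp; done)
  have hX : Sform (m + 1) p x σ β (iW m) (iX m) = 0 := by
    simp only [Sform, iX, iY, iZ, iW, Fin.ext_iff, true_and, and_true, false_and, and_false,
      ↓reduceIte, ↓reduceDIte] <;> (try split_ifs) <;> first | rfl | (exfalso; omega) | (casesm* _ ∧ _ <;> contradiction) | (congr 1; apply Fin.ext; simp; done)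
  simp [hX, hY, hZ, hW]

lemma ip_eq (u v : Fin (2 * (m + 1)) → ℝ) : ip (m + 1) (Sform (m + 1) p x σ β) u v =
    u (iX m) * (p * v (iX m) + ∑ j : Fin m, x j * v (iY j))
    + ∑ j : Fin m, u (iY j) * (x j * v (iX m) + σ j * v (iY j))
    + ∑ j : Fin m, u (iZ j) * (σ j * v (iZ j)) + u (iW m) * (β * v (iW m)) := by
  simp only [ip, dotProduct, sum_idx, S_X, S_Y, S_Z, S_W]

variable {p x σ β}

lemma nabla_unique (hσ : ∀ i, 0 < σ i) (hβ : 0 < β) (hz : 0 < zval (m + 1) p x σ)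
    {u v c : Fin (2 * (m + 1)) → ℝ}
    (h : ∀ t, koszul (m + 1) (Sform (m + 1) p x σ β) u v t
      = 2 * (Sform (m + 1) p x σ β).mulVec c t) :
    nabla (m + 1) (Sform (m + 1) p x σ β) u v = c := by
  have hu : IsUnit (Sform (m + 1) p x σ β) := by
    rw [← Matrix.mulVec_injective_iff_isUnit]
    rw [← Matrix.coe_mulVecLin, ← LinearMap.ker_eq_bot, LinearMap.ker_eq_bot']
    intro c hc
    rw [Matrix.mulVecLin_apply] at hc
    have cX := congrFun hc (iX m)
    have cY := fun k => congrFun hc (iY k)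
    have cZ := fun k => congrFun hc (iZ k)
    have cW := congrFun hc (iW m)
    simp only [S_X, S_Y, S_Z, S_W, Pi.zero_apply] at cX cY cZ cW
    have hY : ∀ k, c (iY k) = - (x k / σ k) * c (iX m) := by
      intro k
      have := cY k
      have := (hσ k).ne'
      field_simp
      linarith
    have hX : c (iX m) = 0 := by
      have e : ∑ j : Fin m, x j * c (iY j) = - (∑ j : Fin m, x j ^ 2 / σ j) * c (iX m) := by
        rw [neg_mul, Finset.sum_mul, ← Finset.sum_neg_distrib]
        refine Finset.sum_congr rfl fun j _ => ?_
        rw [hY j]; ring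
      rw [e] at cX
      have : zval (m + 1) p x σ * c (iX m) = 0 := by
        unfold zval
        rw [sub_mul]
        simpa [sub_eq_add_neg] using cX
      exact (mul_eq_zero.mp this).resolve_left hz.ne'
    funext k
    refine idx_cases (P := fun k => c k = (0 : Fin (2 * (m + 1)) → ℝ) k) hX ?_ ?_ ?_ k
    · intro j; simp [hY j, hX]
    · intro j; exact (mul_eq_zero.mp (cZ j)).resolve_left (hσ j).ne'
    · exact (mul_eq_zero.mp cW).resolve_left hβ.ne'
  have hk : koszul (m + 1) (Sform (m + 1) p x σ β) u v
      = (2 : ℝ) • (Sform (m + 1) p x σ β).mulVec c := by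
    funext t; simp [h t]
  rw [nabla, hk, Matrix.mulVec_smul, smul_smul, Matrix.mulVec_mulVec,
    Matrix.nonsing_inv_mul _ ((Matrix.isUnit_iff_isUnit_det _).mp hu)]
  simp

/-- vector from components -/
def mk (a : ℝ) (y ζ : Fin m → ℝ) (w : ℝ) : Fin (2 * (m + 1)) → ℝ :=
  a • Pi.single (iX m) 1 + ∑ j, y j • Pi.single (iY j) 1 + ∑ j, ζ j • Pi.single (iZ j) 1
    + w • Pi.single (iW m) 1

variable (a : ℝ) (y ζ : Fin m → ℝ) (w : ℝ)

lemma mk_X : mk a y ζ w (iX m) = a := by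
  simp [mk, Pi.single_apply, XY, YX, XZ, ZX, XW, WX, YZ, ZY, YW, WY, ZW, WZ, YY, ZZ]
lemma mk_Y (j : Fin m) : mk a y ζ w (iY j) = y j := by
  simp [mk, Pi.single_apply, XY, YX, XZ, ZX, XW, WX, YZ, ZY, YW, WY, ZW, WZ, YY, ZZ]
lemma mk_Z (j : Fin m) : mk a y ζ w (iZ j) = ζ j := by
  simp [mk, Pi.single_apply, XY, YX, XZ, ZX, XW, WX, YZ, ZY, YW, WY, ZW, WZ, YY, ZZ]
lemma mk_W : mk a y ζ w (iW m) = w := by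
  simp [mk, Pi.single_apply, XY, YX, XZ, ZX, XW, WX, YZ, ZY, YW, WY, ZW, WZ, YY, ZZ]

/-- the `X`-component of `∇_X v` -/
def rX (p : ℝ) (x σ : Fin m → ℝ) (v : Fin (2 * (m + 1)) → ℝ) : ℝ :=
  (∑ j, x j * v (iY j) + v (iX m) * ∑ j, x j ^ 2 / σ j) / (2 * zval (m + 1) p x σ)

lemma nabla_X (hσ : ∀ i, 0 < σ i) (hβ : 0 < β) (hz : 0 < zval (m + 1) p x σ)
    (v : Fin (2 * (m + 1)) → ℝ) :
    nabla (m + 1) (Sform (m + 1) p x σ β) (Pi.single (iX m) 1) v =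
      mk (rX p x σ v) (fun j => - (x j / σ j) * (v (iX m) / 2 + rX p x σ v)) 0 0 := by
  apply nabla_unique hσ hβ hz
  intro t
  have hs : ∀ k, σ k * (x k / σ k) = x k := fun k => by have := (hσ k).ne'; field_simp
  revert t
  refine idx_cases ?_ ?_ ?_ ?_
  · have e : ∑ j : Fin m, x j * (- (x j / σ j) * (v (iX m) / 2 + rX p x σ v)) =
        - (∑ j : Fin m, x j ^ 2 / σ j) * (v (iX m) / 2 + rX p x σ v) := by
      rw [neg_mul, Finset.sum_mul, ← Finset.sum_neg_distrib]
      exact Finset.sum_congr rfl fun j _ => by ring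
    have e2 : zval (m + 1) p x σ * (2 * rX p x σ v) = 
        ∑ j, x j * v (iY j) + v (iX m) * ∑ j, x j ^ 2 / σ j := by
      unfold rX; field_simp
    have e3 : zval (m + 1) p x σ = p - ∑ j : Fin m, x j ^ 2 / σ j := rfl
    rw [e3] at e2
    simp only [S_X, mk_X, mk_Y, e]
    simp only [koszul, ip_eq, bracket_X, bracket_Y, bracket_Z, bracket_W]
    simp [Pi.single_apply, XY, YX, XZ, ZX, XW, WX, YZ, ZY, YW, WY, ZW, WZ, YY, ZZ]
    have e4 : ∑ j : Fin m, v (iY j) / 2 * x j = (∑ j : Fin m, x j * v (iY j)) / 2 := by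
      rw [Finset.sum_div]
      exact Finset.sum_congr rfl fun j _ => by ring
    have e5 : ∑ j : Fin m, -(v (iY j)) / 2 * x j = - (∑ j : Fin m, x j * v (iY j)) / 2 := by
      rw [← Finset.sum_neg_distrib, Finset.sum_div]
      exact Finset.sum_congr rfl fun j _ => by ring
    rw [e4, e5]
    linarith
  · intro k
    simp only [S_Y, mk_X, mk_Y]
    simp only [koszul, ip_eq, bracket_X, bracket_Y, bracket_Z, bracket_W]
    simp [Pi.single_apply, XY, YX, XZ, ZX, XW, WX, YZ, ZY, YW, WY, ZW, WZ, YY, ZZ, ite_div,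
      neg_div]
    linear_combination (-(v (iX m) + 2 * rX p x σ v)) * (-(hs k))
  · intro k
    simp only [S_Z, mk_Z]
    simp only [koszul, ip_eq, bracket_X, bracket_Y, bracket_Z, bracket_W]
    simp [Pi.single_apply, XY, YX, XZ, ZX, XW, WX, YZ, ZY, YW, WY, ZW, WZ, YY, ZZ, ite_div,
      neg_div]
    ring
  · simp only [S_W, mk_W]
    simp only [koszul, ip_eq, bracket_X, bracket_Y, bracket_Z, bracket_W]
    simp [Pi.single_apply, XY, YX, XZ, ZX, XW, WX, YZ, ZY, YW, WY, ZW, WZ, YY, ZZ, ite_div,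
      neg_div]
    try ring

/-- the `X`-component of `∇_{Y_i} v` -/
def rY (p : ℝ) (x σ : Fin m → ℝ) (i : Fin m) (v : Fin (2 * (m + 1)) → ℝ) : ℝ :=
  (σ i * v (iY i) + x i * v (iX m)) / (2 * zval (m + 1) p x σ)

lemma nabla_Y (hσ : ∀ i, 0 < σ i) (hβ : 0 < β) (hz : 0 < zval (m + 1) p x σ) (i : Fin m)
    (r : ℝ) (v : Fin (2 * (m + 1)) → ℝ) :
    nabla (m + 1) (Sform (m + 1) p x σ β) (r • Pi.single (iY i) 1) v =
      r • mk (rY p x σ i v)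
        (fun j => - (x j / σ j) * rY p x σ i v - if j = i then v (iX m) / 2 else 0)
        (fun j => if j = i then β * v (iW m) / (2 * σ i) else 0) (- v (iZ i) / 2) := by
  apply nabla_unique hσ hβ hz
  intro t
  have hs : ∀ k, σ k * (x k / σ k) = x k := fun k => by have := (hσ k).ne'; field_simp
  rw [Matrix.mulVec_smul, Pi.smul_apply, smul_eq_mul]
  revert t
  refine idx_cases ?_ ?_ ?_ ?_
  · have e : ∑ j : Fin m, x j * (- (x j / σ j) * rY p x σ i v
          - if j = i then v (iX m) / 2 else 0) =
        - (∑ j : Fin m, x j ^ 2 / σ j) * rY p x σ i v - x i * (v (iX m) / 2) := by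
      simp only [mul_sub, Finset.sum_sub_distrib]
      congr 1
      · rw [neg_mul, Finset.sum_mul, ← Finset.sum_neg_distrib]
        exact Finset.sum_congr rfl fun j _ => by ring
      · simp
    have e2 : zval (m + 1) p x σ * (2 * rY p x σ i v) = σ i * v (iY i) + x i * v (iX m) := by
      unfold rY; field_simp
    have e3 : zval (m + 1) p x σ = p - ∑ j : Fin m, x j ^ 2 / σ j := rfl
    rw [e3] at e2
    simp only [S_X, mk_X, mk_Y, e]
    simp only [koszul, ip_eq, bracket_X, bracket_Y, bracket_Z, bracket_W]
    simp [Pi.single_apply, XY, YX, XZ, ZX, XW, WX, YZ, ZY, YW, WY, ZW, WZ, YY, ZZ, ite_div,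
      neg_div]
    linear_combination (-r) * e2
  · intro k
    simp only [S_Y, mk_X, mk_Y]
    simp only [koszul, ip_eq, bracket_X, bracket_Y, bracket_Z, bracket_W]
    simp [Pi.single_apply, XY, YX, XZ, ZX, XW, WX, YZ, ZY, YW, WY, ZW, WZ, YY, ZZ, ite_div,
      neg_div]
    have := hs k
    by_cases h : k = i
    · subst h
      simp
      linear_combination (2 * r * rY p x σ k v) * this
    · have h' : ¬ (i = k) := fun h' => h h'.symm
      simp [h, h']
      right
      linear_combination (-rY p x σ i v) * this
  · intro k
    simp only [S_Z, mk_Z]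
    simp only [koszul, ip_eq, bracket_X, bracket_Y, bracket_Z, bracket_W]
    simp [Pi.single_apply, XY, YX, XZ, ZX, XW, WX, YZ, ZY, YW, WY, ZW, WZ, YY, ZZ, ite_div,
      neg_div]
    by_cases h : k = i
    · subst h
      have := (hσ k).ne'
      simp
      field_simp
    · have h' : ¬ (i = k) := fun h' => h h'.symm
      simp [h, h']
  · simp only [S_W, mk_W]
    simp only [koszul, ip_eq, bracket_X, bracket_Y, bracket_Z, bracket_W]
    simp [Pi.single_apply, XY, YX, XZ, ZX, XW, WX, YZ, ZY, YW, WY, ZW, WZ, YY, ZZ, ite_div,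
      neg_div]
    ring

lemma bracket_XY (i : Fin m) : bracket (m + 1) (Pi.single (iX m) 1) (Pi.single (iY i) 1)
    = (1 / 2 : ℝ) • Pi.single (iY i) 1 := by
  funext t
  refine idx_cases (P := fun t => bracket (m + 1) (Pi.single (iX m) 1) (Pi.single (iY i) 1) t
    = ((1 / 2 : ℝ) • Pi.single (iY i) 1 : Fin (2 * (m + 1)) → ℝ) t) ?_ ?_ ?_ ?_ t
  all_goals
    simp [Pi.single_apply, XY, YX, XZ, ZX, XW, WX, YZ, ZY, YW, WY, ZW, WZ, YY, ZZ, ite_div,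
      bracket_X, bracket_Y, bracket_Z, bracket_W]

lemma main (hσ : ∀ i, 0 < σ i) (hβ : 0 < β) (hz : 0 < zval (m + 1) p x σ) (i : Fin m)
    (v : Fin (2 * (m + 1)) → ℝ) :
    curv (m + 1) (Sform (m + 1) p x σ β) (Pi.single (iX m) 1) (Pi.single (iY i) 1) v
      = (-(1 / (4 * zval (m + 1) p x σ))) •
          wedge (m + 1) (Sform (m + 1) p x σ β) (Pi.single (iX m) 1) (Pi.single (iY i) 1) v
        - (1 / (4 * σ i)) •
          wedge (m + 1) (Sform (m + 1) p x σ β) (Pi.single (iZ i) 1) (Pi.single (iW m) 1) v := by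
  have hY := fun v => nabla_Y hσ hβ hz i 1 v
  simp only [one_smul] at hY
  have h1 : rX p x σ (mk (rY p x σ i v)
        (fun j => - (x j / σ j) * rY p x σ i v - if j = i then v (iX m) / 2 else 0)
        (fun j => if j = i then β * v (iW m) / (2 * σ i) else 0) (- v (iZ i) / 2))
      = - (x i * v (iX m)) / (4 * zval (m + 1) p x σ) := by
    have e : ∑ j : Fin m, x j * (- (x j / σ j) * rY p x σ i v
          - if j = i then v (iX m) / 2 else 0) =
        - (∑ j : Fin m, x j ^ 2 / σ j) * rY p x σ i v - x i * (v (iX m) / 2) := by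
      simp only [mul_sub, Finset.sum_sub_distrib]
      congr 1
      · rw [neg_mul, Finset.sum_mul, ← Finset.sum_neg_distrib]
        exact Finset.sum_congr rfl fun j _ => by ring
      · simp
    simp only [rX, mk_X, mk_Y, e]
    field_simp
    ring
  have h2 : rY p x σ i (mk (rX p x σ v)
        (fun j => - (x j / σ j) * (v (iX m) / 2 + rX p x σ v)) 0 0)
      = - (x i * v (iX m)) / (4 * zval (m + 1) p x σ) := by
    have := (hσ i).ne'
    simp only [rY, mk_X, mk_Y]
    field_simp
    ring
  have h3 : rY p x σ i v = (σ i * v (iY i) + x i * v (iX m)) / (2 * zval (m + 1) p x σ) := rfl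
  have h4 : 2 * zval (m + 1) p x σ * rX p x σ v
      = (∑ j, x j * v (iY j) + v (iX m) * (p - zval (m + 1) p x σ)) := by
    have : p - zval (m + 1) p x σ = ∑ j : Fin m, x j ^ 2 / σ j := by
      simp [zval]
    rw [this, rX]; field_simp
  have hσi := (hσ i).ne'
  unfold curv
  rw [bracket_XY, nabla_Y hσ hβ hz, nabla_X hσ hβ hz v, hY, hY, nabla_X hσ hβ hz, h1, h2]
  refine funext ?_
  refine idx_cases ?_ ?_ ?_ ?_
  · simp [wedge, ip_eq, mk_X, mk_Y, mk_Z, mk_W, Pi.single_apply, XY, YX, XZ, ZX, XW, WX, YZ, ZY,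
      YW, WY, ZW, WZ, YY, ZZ, h3]
    field_simp
    ring
  · intro k
    have := (hσ k).ne'
    simp [wedge, ip_eq, mk_X, mk_Y, mk_Z, mk_W, Pi.single_apply, XY, YX, XZ, ZX, XW, WX, YZ, ZY,
      YW, WY, ZW, WZ, YY, ZZ]
    by_cases h : k = i
    · subst h
      simp
      have : rX p x σ v = (∑ j, x j * v (iY j) + v (iX m) * (p - zval (m + 1) p x σ))
          / (2 * zval (m + 1) p x σ) := by rw [← h4]; field_simp
      rw [this, h3]
      field_simp
      ring
    · simp [h]
      rw [h3]
      field_simp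
      ring
  · intro k
    simp [wedge, ip_eq, mk_X, mk_Y, mk_Z, mk_W, Pi.single_apply, XY, YX, XZ, ZX, XW, WX, YZ, ZY,
      YW, WY, ZW, WZ, YY, ZZ]
    by_cases h : k = i
    · subst h
      simp
      field_simp
      try ring
    · simp [h]
  · simp [wedge, ip_eq, mk_X, mk_Y, mk_Z, mk_W, Pi.single_apply, XY, YX, XZ, ZX, XW, WX, YZ, ZY,
      YW, WY, ZW, WZ, YY, ZZ]
    field_simp
    try ring

end S

/-- `R(X, Y_i) = -(1/(4z)) X∧Y_i - (1/(4σ_i)) Z_i∧W`. -/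
theorem curv_X_Y (n : ℕ) (hn : 2 ≤ n) (p β : ℝ) (x σ : Fin (n - 1) → ℝ)
    (hadm : Admissible n p x σ β) (hz : 0 < zval n p x σ) :
    let S := Sform n p x σ β
    let z := zval n p x σ
    let X : Fin (2 * n) → ℝ := Pi.single ⟨0, by omega⟩ 1
    let Y : Fin (n - 1) → Fin (2 * n) → ℝ :=
      fun i => Pi.single ⟨i.val + 1, by have := i.isLt; omega⟩ 1
    let Z : Fin (n - 1) → Fin (2 * n) → ℝ :=
      fun i => Pi.single ⟨i.val + n, by have := i.isLt; omega⟩ 1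
    let W : Fin (2 * n) → ℝ := Pi.single ⟨2 * n - 1, by omega⟩ 1
    ∀ i, curv n S X (Y i)
      = (-(1 / (4 * z))) • wedge n S X (Y i)
        - (1 / (4 * σ i)) • wedge n S (Z i) W := by
  obtain ⟨m, rfl⟩ : ∃ m, n = m + 1 := ⟨n - 1, by omega⟩
  intro S z X Y Z W i
  funext v
  obtain ⟨-, hβ, -, -, hσ, -⟩ := hadm
  exact main (m := m) (fun i => lt_of_lt_of_le one_pos (hσ i)) hβ hz i v

end CHn
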